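/- arXiv:2106.08635 — 3 statements merged into one kernel-verified Lean document; each statement's English description precedes it below -/
import Mathlib

section
/- Let A, B, C be smooth vector fields on an open subset of ℝ² with A(x), B(x) linearly independent at each point, and let μ₀, μ₁, γ₀, γ₁ be the structure functions defined by [A,B] = μ₀A + μ₁B and C = γ₀A + γ₁B. Let α be a smooth function. (Elliptic case) Set A~ = A cos α + B sin α, B~ = −A sin α + B cos α; then [A~,B~] = μ~₀A~ + μ~₁B~ and C = γ~₀A~ + γ~₁B~ where (μ~₀, μ~₁) = (μ₀ − L_Aα, μ₁ − L_Bα)·R_E(α) and (γ~₀, γ~₁) = (γ₀, γ₁)·R_E(α), with R_E(α) the matrix with rows (cos α, −sin α) and (sin α, cos α). (Hyperbolic case) Set A~ = A cosh α + B sinh α, B~ = A sinh α + B cosh α; then [A~,B~] = μ~₀A~ + μ~₁B~ and C = γ~₀A~ + γ~₁B~ where (μ~₀, μ~₁) = (μ₀ + L_Aα, μ₁ − L_Bα)·R_H(α) and (γ~₀, γ~₁) = (γ₀, γ₁)·R_H(α), with R_H(α) the matrix with rows (cosh α, −sinh α) and (−sinh α, cosh α). -/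
noncomputable section

open Set

/-- Lie bracket `[A,B](x) = DB(x)A(x) − DA(x)B(x)` of vector fields on `ℝ²`. -/
def lieB (A B : (ℝ × ℝ) → ℝ × ℝ) : (ℝ × ℝ) → ℝ × ℝ :=
  fun x => fderiv ℝ B x (A x) - fderiv ℝ A x (B x)

/-- Lie derivative `L_A h = Dh·A` of a function along a vector field on `ℝ²`. -/
def lieD (A : (ℝ × ℝ) → ℝ × ℝ) (h : (ℝ × ℝ) → ℝ) : (ℝ × ℝ) → ℝ :=
  fun x => fderiv ℝ h x (A x)

/-- Lie bracket of two combinations of `A`, `B` with coefficients depending on `α`. -/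
theorem lieB_comb {A B : (ℝ × ℝ) → ℝ × ℝ} {α : (ℝ × ℝ) → ℝ} {x : ℝ × ℝ}
    (hA : DifferentiableAt ℝ A x) (hB : DifferentiableAt ℝ B x) (hα : DifferentiableAt ℝ α x)
    {p q r s : ℝ → ℝ} {dp dq dr ds : ℝ}
    (hp : HasDerivAt p dp (α x)) (hq : HasDerivAt q dq (α x))
    (hr : HasDerivAt r dr (α x)) (hs : HasDerivAt s ds (α x)) :
    lieB (fun y => p (α y) • A y + q (α y) • B y) (fun y => r (α y) • A y + s (α y) • B y) x
      = (p (α x) * s (α x) - q (α x) * r (α x)) • lieB A B x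
        + (p (α x) * lieD A α x + q (α x) * lieD B α x) • (dr • A x + ds • B x)
        - (r (α x) * lieD A α x + s (α x) * lieD B α x) • (dp • A x + dq • B x) := by
  have h1 := ((hp.comp_hasFDerivAt x hα.hasFDerivAt).smul hA.hasFDerivAt).add
    ((hq.comp_hasFDerivAt x hα.hasFDerivAt).smul hB.hasFDerivAt)
  have h2 := ((hr.comp_hasFDerivAt x hα.hasFDerivAt).smul hA.hasFDerivAt).add
    ((hs.comp_hasFDerivAt x hα.hasFDerivAt).smul hB.hasFDerivAt)
  have e1 : fderiv ℝ (fun y => p (α y) • A y + q (α y) • B y) x = _ := h1.fderiv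
  have e2 : fderiv ℝ (fun y => r (α y) • A y + s (α y) • B y) x = _ := h2.fderiv
  unfold lieB lieD
  rw [e1, e2]
  simp only [add_apply, smul_apply,
    ContinuousLinearMap.smulRight_apply, map_add, map_smul, smul_eq_mul, Function.comp_apply]
  module

/-- behaviour of the structure functions `μ₀, μ₁, γ₀, γ₁`
(`[A,B] = μ₀A + μ₁B`, `C = γ₀A + γ₁B`) under the elliptic rotation
`A~ = A cos α + B sin α`, `B~ = −A sin α + B cos α` and the hyperbolic rotation
`A~ = A cosh α + B sinh α`, `B~ = A sinh α + B cosh α`: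
`(μ~₀, μ~₁) = (μ₀ ∓ L_Aα, μ₁ − L_Bα)·R(α)` and `(γ~₀, γ~₁) = (γ₀, γ₁)·R(α)`. -/
theorem stmt_13 (U : Set (ℝ × ℝ)) (hU : IsOpen U)
    (A B C : (ℝ × ℝ) → ℝ × ℝ) (α : (ℝ × ℝ) → ℝ)
    (hA : ContDiffOn ℝ (⊤ : ℕ∞) A U) (hB : ContDiffOn ℝ (⊤ : ℕ∞) B U) (hC : ContDiffOn ℝ (⊤ : ℕ∞) C U)
    (hα : ContDiffOn ℝ (⊤ : ℕ∞) α U)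
    (hAB : ∀ x ∈ U, LinearIndependent ℝ ![A x, B x])
    (μ₀ μ₁ γ₀ γ₁ : (ℝ × ℝ) → ℝ)
    (hμ : ∀ x ∈ U, lieB A B x = μ₀ x • A x + μ₁ x • B x)
    (hγ : ∀ x ∈ U, C x = γ₀ x • A x + γ₁ x • B x) :
    -- elliptic case
    ((∀ x ∈ U,
      lieB (fun y => Real.cos (α y) • A y + Real.sin (α y) • B y)
           (fun y => (-Real.sin (α y)) • A y + Real.cos (α y) • B y) x
        = ((μ₀ x - lieD A α x) * Real.cos (α x) + (μ₁ x - lieD B α x) * Real.sin (α x))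
            • (Real.cos (α x) • A x + Real.sin (α x) • B x)
        + (-(μ₀ x - lieD A α x) * Real.sin (α x) + (μ₁ x - lieD B α x) * Real.cos (α x))
            • ((-Real.sin (α x)) • A x + Real.cos (α x) • B x)) ∧
     (∀ x ∈ U,
      C x
        = (γ₀ x * Real.cos (α x) + γ₁ x * Real.sin (α x))
            • (Real.cos (α x) • A x + Real.sin (α x) • B x)
        + (-γ₀ x * Real.sin (α x) + γ₁ x * Real.cos (α x))
            • ((-Real.sin (α x)) • A x + Real.cos (α x) • B x)))
    ∧
    -- hyperbolic case
    ((∀ x ∈ U,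
      lieB (fun y => Real.cosh (α y) • A y + Real.sinh (α y) • B y)
           (fun y => Real.sinh (α y) • A y + Real.cosh (α y) • B y) x
        = ((μ₀ x + lieD A α x) * Real.cosh (α x) - (μ₁ x - lieD B α x) * Real.sinh (α x))
            • (Real.cosh (α x) • A x + Real.sinh (α x) • B x)
        + (-(μ₀ x + lieD A α x) * Real.sinh (α x) + (μ₁ x - lieD B α x) * Real.cosh (α x))
            • (Real.sinh (α x) • A x + Real.cosh (α x) • B x)) ∧
     (∀ x ∈ U,
      C x
        = (γ₀ x * Real.cosh (α x) - γ₁ x * Real.sinh (α x))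
            • (Real.cosh (α x) • A x + Real.sinh (α x) • B x)
        + (-γ₀ x * Real.sinh (α x) + γ₁ x * Real.cosh (α x))
            • (Real.sinh (α x) • A x + Real.cosh (α x) • B x))) := by
  have dA : ∀ x ∈ U, DifferentiableAt ℝ A x := fun x hx =>
    (hA.contDiffAt (hU.mem_nhds hx)).differentiableAt (by simp)
  have dB : ∀ x ∈ U, DifferentiableAt ℝ B x := fun x hx =>
    (hB.contDiffAt (hU.mem_nhds hx)).differentiableAt (by simp)
  have dα : ∀ x ∈ U, DifferentiableAt ℝ α x := fun x hx =>
    (hα.contDiffAt (hU.mem_nhds hx)).differentiableAt (by simp)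
  refine ⟨⟨fun x hx => ?_, fun x hx => ?_⟩, ⟨fun x hx => ?_, fun x hx => ?_⟩⟩
  · have h := lieB_comb (dA x hx) (dB x hx) (dα x hx) (Real.hasDerivAt_cos (α x))
      (Real.hasDerivAt_sin (α x)) (Real.hasDerivAt_sin (α x)).neg (Real.hasDerivAt_cos (α x))
    simp only [Pi.neg_apply] at h
    rw [h, hμ x hx]
    module
  · have h := Real.cos_sq_add_sin_sq (α x)
    have e : C x = (Real.cos (α x) ^ 2 + Real.sin (α x) ^ 2) • (γ₀ x • A x + γ₁ x • B x) := by
      rw [h, one_smul, hγ x hx]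
    rw [e]
    module
  · rw [lieB_comb (dA x hx) (dB x hx) (dα x hx) (Real.hasDerivAt_cosh (α x))
      (Real.hasDerivAt_sinh (α x)) (Real.hasDerivAt_sinh (α x)) (Real.hasDerivAt_cosh (α x)),
      hμ x hx]
    module
  · have h := Real.cosh_sq_sub_sinh_sq (α x)
    have e : C x = (Real.cosh (α x) ^ 2 - Real.sinh (α x) ^ 2) • (γ₀ x • A x + γ₁ x • B x) := by
      rw [h, one_smul, hγ x hx]
    rw [e]
    module
end
end

section
/- Let A, B be smooth vector fields on an open subset of ℝ² with A(x), B(x) linearly independent at each point, and let μ₀, μ₁ be the structure functions defined by [A,B] = μ₀A + μ₁B. (Elliptic case) The following are equivalent locally around x₀: (i) there exists a smooth function α near x₀ such that A~ = A cos α + B sin α and B~ = −A sin α + B cos α satisfy [A~,B~] = 0; (ii) −μ₀² − μ₁² + L_Aμ₁ − L_Bμ₀ = 0 on a neighbourhood of x₀. (Hyperbolic case) The following are equivalent locally around x₀: (i) there exists a smooth α such that A~ = A cosh α + B sinh α and B~ = A sinh α + B cosh α satisfy [A~,B~] = 0; (ii) −μ₀² + μ₁² − L_Aμ₁ − L_Bμ₀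 = 0 on a neighbourhood of x₀. -/
noncomputable section

open Set

theorem bracket_gen {A B : (ℝ × ℝ) → ℝ × ℝ} {c s h k : (ℝ × ℝ) → ℝ} {x : ℝ × ℝ}
    (hA : DifferentiableAt ℝ A x) (hB : DifferentiableAt ℝ B x)
    {L : (ℝ × ℝ) →L[ℝ] ℝ} {c' s' h' k' : ℝ}
    (hc : HasFDerivAt c (c' • L) x) (hs : HasFDerivAt s (s' • L) x)
    (hh : HasFDerivAt h (h' • L) x) (hk : HasFDerivAt k (k' • L) x) :
    lieB (fun y => c y • A y + s y • B y) (fun y => h y • A y + k y • B y) x =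
      (h' * (c x * L (A x) + s x * L (B x)) - c' * (h x * L (A x) + k x * L (B x))) • A x
      + (k' * (c x * L (A x) + s x * L (B x)) - s' * (h x * L (A x) + k x * L (B x))) • B x
      + (c x * k x - s x * h x) • lieB A B x := by
  have h1 := (hc.smul hA.hasFDerivAt).add (hs.smul hB.hasFDerivAt)
  have h2 := (hh.smul hA.hasFDerivAt).add (hk.smul hB.hasFDerivAt)
  have e1 : fderiv ℝ (fun y => c y • A y + s y • B y) x = _ := h1.fderiv
  have e2 : fderiv ℝ (fun y => h y • A y + k y • B y) x = _ := h2.fderiv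
  simp only [lieB, e1, e2]
  simp only [add_apply, smul_apply,
    ContinuousLinearMap.smulRight_apply, map_add, map_smul, smul_eq_mul]
  module

theorem det_ne {a b : ℝ × ℝ} (h : LinearIndependent ℝ ![a, b]) :
    a.1 * b.2 - a.2 * b.1 ≠ 0 := by
  intro hd
  rw [LinearIndependent.pair_iff] at h
  have h1 := h b.2 (-a.2) (by ext <;> simp <;> linarith)
  have h2 := h b.1 (-a.1) (by ext <;> simp <;> linarith)
  have h3 := h 1 1 (by
    ext <;> simp <;> linarith [h1.1, h1.2, h2.1, h2.2])
  exact one_ne_zero h3.1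

/-- In the plane, a bilinear form symmetric on a basis is symmetric. -/
theorem symm_of_basis {a b : ℝ × ℝ} (h : a.1 * b.2 - a.2 * b.1 ≠ 0)
    (T : (ℝ × ℝ) →L[ℝ] (ℝ × ℝ) →L[ℝ] ℝ) (hT : T a b = T b a) (v w : ℝ × ℝ) :
    T v w = T w v := by
  have key : ∀ v : ℝ × ℝ, v = ((v.1 * b.2 - v.2 * b.1) / (a.1 * b.2 - a.2 * b.1)) • a +
      ((a.1 * v.2 - a.2 * v.1) / (a.1 * b.2 - a.2 * b.1)) • b := by
    intro v
    have h1 := mul_inv_cancel₀ h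
    ext
    · simp only [div_eq_mul_inv, Prod.fst_add, Prod.smul_fst, smul_eq_mul]
      linear_combination (-v.1) * h1
    · simp only [div_eq_mul_inv, Prod.snd_add, Prod.smul_snd, smul_eq_mul]
      linear_combination (-v.2) * h1
  rw [key v, key w]
  simp only [map_add, map_smul, add_apply, smul_apply,
    smul_eq_mul, hT]
  ring

theorem integrability (U : Set (ℝ × ℝ)) (hU : IsOpen U) (x₀ : ℝ × ℝ) (hx₀ : x₀ ∈ U)
    (A B : (ℝ × ℝ) → ℝ × ℝ)
    (hA : ContDiffOn ℝ (⊤ : ℕ∞) A U) (hB : ContDiffOn ℝ (⊤ : ℕ∞) B U)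
    (hAB : ∀ x ∈ U, LinearIndependent ℝ ![A x, B x])
    (μ₀ μ₁ : (ℝ × ℝ) → ℝ)
    (hμ : ∀ x ∈ U, lieB A B x = μ₀ x • A x + μ₁ x • B x)
    (p q : (ℝ × ℝ) → ℝ)
    (hp : ContDiffOn ℝ (⊤ : ℕ∞) p U) (hq : ContDiffOn ℝ (⊤ : ℕ∞) q U) :
    (∃ (α : (ℝ × ℝ) → ℝ) (U₀ : Set (ℝ × ℝ)), IsOpen U₀ ∧ x₀ ∈ U₀ ∧ U₀ ⊆ U ∧
        ContDiffOn ℝ (⊤ : ℕ∞) α U₀ ∧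
        ∀ x ∈ U₀, fderiv ℝ α x (A x) = p x ∧ fderiv ℝ α x (B x) = q x) ↔
      (∃ U₀ : Set (ℝ × ℝ), IsOpen U₀ ∧ x₀ ∈ U₀ ∧ U₀ ⊆ U ∧
          ∀ x ∈ U₀, μ₀ x * p x + μ₁ x * q x = lieD A q x - lieD B p x) := by
  have dA : ∀ x ∈ U, DifferentiableAt ℝ A x := fun x hx =>
    (hA.contDiffAt (hU.mem_nhds hx)).differentiableAt (by simp)
  have dB : ∀ x ∈ U, DifferentiableAt ℝ B x := fun x hx =>
    (hB.contDiffAt (hU.mem_nhds hx)).differentiableAt (by simp)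
  constructor
  · rintro ⟨α, U₀, ho, hx, hsub, hα, h⟩
    refine ⟨U₀, ho, hx, hsub, fun x hx => ?_⟩
    have hn := ho.mem_nhds hx
    have key := VectorField.fderiv_apply_lieBracket (V := A) (W := B) (hα.contDiffAt hn)
      (by
        rw [minSmoothness_of_isRCLikeNormedField]
        exact WithTop.coe_le_coe.2 (le_top : (2 : ℕ∞) ≤ ⊤))
      (dB x (hsub hx)) (dA x (hsub hx))
    have e1 : (fun x => fderiv ℝ α x (B x)) =ᶠ[nhds x] q := by
      filter_upwards [hn] with y hy using (h y hy).2
    have e2 : (fun x => fderiv ℝ α x (A x)) =ᶠ[nhds x] p := by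
      filter_upwards [hn] with y hy using (h y hy).1
    have e3 : VectorField.lieBracket ℝ A B x = lieB A B x := rfl
    rw [e1.fderiv_eq, e2.fderiv_eq, e3, hμ x (hsub hx), map_add, map_smul, map_smul,
      (h x hx).1, (h x hx).2] at key
    simpa [lieD] using key
  · rintro ⟨U₀, ho, hx, hsub, h⟩
    obtain ⟨r, hr, hball⟩ := Metric.isOpen_iff.1 ho x₀ hx
    have hbU : Metric.ball x₀ r ⊆ U := hball.trans hsub
    let D : (ℝ × ℝ) → ℝ := fun x => (A x).1 * (B x).2 - (A x).2 * (B x).1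
    have hD : ∀ x ∈ U, D x ≠ 0 := fun x hx => det_ne (hAB x hx)
    let ω : (ℝ × ℝ) → (ℝ × ℝ) →L[ℝ] ℝ := fun x =>
      ((p x * (B x).2 - q x * (A x).2) / D x) • ContinuousLinearMap.fst ℝ ℝ ℝ +
      ((q x * (A x).1 - p x * (B x).1) / D x) • ContinuousLinearMap.snd ℝ ℝ ℝ
    have hω : ContDiffOn ℝ (⊤ : ℕ∞) ω U := by
      have a1 : ContDiffOn ℝ (⊤ : ℕ∞) (fun x => (A x).1) U := hA.fst
      have a2 : ContDiffOn ℝ (⊤ : ℕ∞) (fun x => (A x).2) U := hA.snd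
      have b1 : ContDiffOn ℝ (⊤ : ℕ∞) (fun x => (B x).1) U := hB.fst
      have b2 : ContDiffOn ℝ (⊤ : ℕ∞) (fun x => (B x).2) U := hB.snd
      have hDs : ContDiffOn ℝ (⊤ : ℕ∞) D U := (a1.mul b2).sub (a2.mul b1)
      exact ((((hp.mul b2).sub (hq.mul a2)).div hDs hD).smul contDiffOn_const).add
        ((((hq.mul a1).sub (hp.mul b1)).div hDs hD).smul contDiffOn_const)
    have hωA : ∀ x ∈ U, ω x (A x) = p x := by
      intro x hx
      have := hD x hx
      simp [ω]
      field_simp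
      simp only [D]; ring
    have hωB : ∀ x ∈ U, ω x (B x) = q x := by
      intro x hx
      have := hD x hx
      simp [ω]
      field_simp
      simp only [D]; ring
    have dω : ∀ x ∈ U, DifferentiableAt ℝ ω x := fun x hx =>
      (hω.contDiffAt (hU.mem_nhds hx)).differentiableAt (by simp)
    have hsym : ∀ x ∈ Metric.ball x₀ r, ∀ v w, fderiv ℝ ω x v w = fderiv ℝ ω x w v := by
      intro x hx
      have hxU := hbU hx
      have hn := hU.mem_nhds hxU
      apply symm_of_basis (hD x hxU)
      have e1 : (fun x => ω x (B x)) =ᶠ[nhds x] q := by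
        filter_upwards [hn] with y hy using hωB y hy
      have e2 : (fun x => ω x (A x)) =ᶠ[nhds x] p := by
        filter_upwards [hn] with y hy using hωA y hy
      have f1 := e1.fderiv_eq (𝕜 := ℝ)
      have f2 := e2.fderiv_eq (𝕜 := ℝ)
      rw [fderiv_clm_apply (dω x hxU) (dB x hxU)] at f1
      rw [fderiv_clm_apply (dω x hxU) (dA x hxU)] at f2
      have g1 := DFunLike.congr_fun f1 (A x)
      have g2 := DFunLike.congr_fun f2 (B x)
      have hh := h x (hball hx)
      have hl := congrArg (ω x) (hμ x hxU)
      simp only [lieB, map_sub, map_add, map_smul, hωA x hxU, hωB x hxU, smul_eq_mul] at hl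
      simp only [lieD] at hh
      simp at g1 g2
      linarith
    obtain ⟨α, hα⟩ := (convex_ball x₀ r).exists_forall_hasFDerivAt_of_fderiv_symmetric
      Metric.isOpen_ball (ω := ω) (fun x hx => (dω x (hbU hx)).differentiableWithinAt) hsym
    refine ⟨α, Metric.ball x₀ r, Metric.isOpen_ball, Metric.mem_ball_self hr, hbU, ?_, ?_⟩
    · rw [contDiffOn_infty_iff_fderiv_of_isOpen Metric.isOpen_ball]
      exact ⟨fun x hx => (hα x hx).differentiableAt.differentiableWithinAt,
        (hω.mono hbU).congr fun x hx => (hα x hx).fderiv⟩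
    · intro x hx
      rw [(hα x hx).fderiv]
      exact ⟨hωA x (hbU hx), hωB x (hbU hx)⟩

/-- for a frame `(A,B)` with structure functions `[A,B] = μ₀A + μ₁B`,
locally around `x₀`: (elliptic) there is a smooth `α` with
`[A cos α + B sin α, −A sin α + B cos α] = 0` iff `−μ₀² − μ₁² + L_Aμ₁ − L_Bμ₀ = 0`;
(hyperbolic) there is a smooth `α` with
`[A cosh α + B sinh α, A sinh α + B cosh α] = 0` iff `−μ₀² + μ₁² − L_Aμ₁ − L_Bμ₀ = 0`. -/
theorem stmt_15 (U : Set (ℝ × ℝ)) (hU : IsOpen U) (x₀ : ℝ × ℝ) (hx₀ : x₀ ∈ U)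
    (A B : (ℝ × ℝ) → ℝ × ℝ)
    (hA : ContDiffOn ℝ (⊤ : ℕ∞) A U) (hB : ContDiffOn ℝ (⊤ : ℕ∞) B U)
    (hAB : ∀ x ∈ U, LinearIndependent ℝ ![A x, B x])
    (μ₀ μ₁ : (ℝ × ℝ) → ℝ)
    (hμ₀ : ContDiffOn ℝ (⊤ : ℕ∞) μ₀ U) (hμ₁ : ContDiffOn ℝ (⊤ : ℕ∞) μ₁ U)
    (hμ : ∀ x ∈ U, lieB A B x = μ₀ x • A x + μ₁ x • B x) :
    -- elliptic case
    ((∃ (α : (ℝ × ℝ) → ℝ) (U₀ : Set (ℝ × ℝ)), IsOpen U₀ ∧ x₀ ∈ U₀ ∧ U₀ ⊆ U ∧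
        ContDiffOn ℝ (⊤ : ℕ∞) α U₀ ∧
        ∀ x ∈ U₀,
          lieB (fun y => Real.cos (α y) • A y + Real.sin (α y) • B y)
               (fun y => (-Real.sin (α y)) • A y + Real.cos (α y) • B y) x = 0)
      ↔ (∃ U₀ : Set (ℝ × ℝ), IsOpen U₀ ∧ x₀ ∈ U₀ ∧ U₀ ⊆ U ∧
          ∀ x ∈ U₀,
            -(μ₀ x) ^ 2 - (μ₁ x) ^ 2 + lieD A μ₁ x - lieD B μ₀ x = 0))
    ∧
    -- hyperbolic case
    ((∃ (α : (ℝ × ℝ) → ℝ) (U₀ : Set (ℝ × ℝ)), IsOpen U₀ ∧ x₀ ∈ U₀ ∧ U₀ ⊆ U ∧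
        ContDiffOn ℝ (⊤ : ℕ∞) α U₀ ∧
        ∀ x ∈ U₀,
          lieB (fun y => Real.cosh (α y) • A y + Real.sinh (α y) • B y)
               (fun y => Real.sinh (α y) • A y + Real.cosh (α y) • B y) x = 0)
      ↔ (∃ U₀ : Set (ℝ × ℝ), IsOpen U₀ ∧ x₀ ∈ U₀ ∧ U₀ ⊆ U ∧
          ∀ x ∈ U₀,
            -(μ₀ x) ^ 2 + (μ₁ x) ^ 2 - lieD A μ₁ x - lieD B μ₀ x = 0)) := by
  have dA : ∀ x ∈ U, DifferentiableAt ℝ A x := fun x hx =>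
    (hA.contDiffAt (hU.mem_nhds hx)).differentiableAt (by simp)
  have dB : ∀ x ∈ U, DifferentiableAt ℝ B x := fun x hx =>
    (hB.contDiffAt (hU.mem_nhds hx)).differentiableAt (by simp)
  constructor
  · have I := integrability U hU x₀ hx₀ A B hA hB hAB μ₀ μ₁ hμ μ₀ μ₁ hμ₀ hμ₁
    refine Iff.trans ?_ (I.trans ?_)
    · refine exists_congr fun α => exists_congr fun U₀ => and_congr_right fun ho =>
        and_congr_right fun _ => and_congr_right fun hsub => and_congr_right fun hα =>
        forall₂_congr fun x hx => ?_
      have dα : HasFDerivAt α (fderiv ℝ α x) x :=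
        ((hα.contDiffAt (ho.mem_nhds hx)).differentiableAt (by simp)).hasFDerivAt
      have hxU := hsub hx
      have hcs := Real.cos_sq_add_sin_sq (α x)
      have hns : HasFDerivAt (fun y => -Real.sin (α y)) ((-Real.cos (α x)) • fderiv ℝ α x) x := by
        have h1 := dα.sin.neg
        have h2 : (-Real.cos (α x)) • fderiv ℝ α x = -(Real.cos (α x) • fderiv ℝ α x) := by
          ext <;> simp
        rw [h2]
        exact h1
      have key := bracket_gen (dA x hxU) (dB x hxU) dα.cos dα.sin
        (h := fun y => -Real.sin (α y)) (h' := -Real.cos (α x))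
        hns dα.cos
      rw [key, hμ x hxU]
      have e : ∀ a b c s m n : ℝ, c ^ 2 + s ^ 2 = 1 →
          (-c * (c * a + s * b) - -s * (-s * a + c * b)) • A x +
            (-s * (c * a + s * b) - c * (-s * a + c * b)) • B x +
            (c * c - s * -s) • (m • A x + n • B x) = (m - a) • A x + (n - b) • B x := by
        intro a b c s m n hcs
        have hc : c ^ 2 = 1 - s ^ 2 := by linarith
        match_scalars <;> ring_nf <;> rw [hc] <;> ring
      rw [e _ _ _ _ _ _ hcs]
      constructor
      · intro h
        have := LinearIndependent.pair_iff.1 (hAB x hxU) _ _ h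
        constructor <;> linarith [this.1, this.2]
      · rintro ⟨h1, h2⟩
        simp [h1, h2]
    · refine exists_congr fun U₀ => and_congr_right fun ho =>
        and_congr_right fun _ => and_congr_right fun hsub =>
        forall₂_congr fun x hx => ?_
      constructor <;> intro h <;> linarith
  · have I := integrability U hU x₀ hx₀ A B hA hB hAB μ₀ μ₁ hμ (fun x => -μ₀ x) μ₁ hμ₀.neg hμ₁
    refine Iff.trans ?_ (I.trans ?_)
    · refine exists_congr fun α => exists_congr fun U₀ => and_congr_right fun ho =>
        and_congr_right fun _ => and_congr_right fun hsub => and_congr_right fun hα =>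
        forall₂_congr fun x hx => ?_
      have dα : HasFDerivAt α (fderiv ℝ α x) x :=
        ((hα.contDiffAt (ho.mem_nhds hx)).differentiableAt (by simp)).hasFDerivAt
      have hxU := hsub hx
      have hcs := Real.cosh_sq (α x)
      have key := bracket_gen (dA x hxU) (dB x hxU) dα.cosh dα.sinh dα.sinh dα.cosh
      rw [key, hμ x hxU]
      have e : ∀ a b c s m n : ℝ, c ^ 2 = s ^ 2 + 1 →
          (c * (c * a + s * b) - s * (s * a + c * b)) • A x +
            (s * (c * a + s * b) - c * (s * a + c * b)) • B x +
            (c * c - s * s) • (m • A x + n • B x) = (m + a) • A x + (n - b) • B x := by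
        intro a b c s m n hc
        match_scalars <;> ring_nf <;> rw [hc] <;> ring
      rw [e _ _ _ _ _ _ hcs]
      constructor
      · intro h
        have := LinearIndependent.pair_iff.1 (hAB x hxU) _ _ h
        constructor <;> linarith [this.1, this.2]
      · rintro ⟨h1, h2⟩
        simp [h1, h2]
    · refine exists_congr fun U₀ => and_congr_right fun ho =>
        and_congr_right fun _ => and_congr_right fun hsub =>
        forall₂_congr fun x hx => ?_
      have e : lieD B (fun x => -μ₀ x) x = - lieD B μ₀ x := by
        simp [lieD, fderiv_fun_neg]
      rw [e]
      constructor <;> intro h <;> linarith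
end
end

section
/- Let A, B be smooth vector fields on an open subset of ℝ² with A(x), B(x) linearly independent at each point (a P-frame). Then, locally around any point x₀, there exist smooth functions α and β with β nonvanishing such that the transformed P-frame A~ = Aβ², B~ = 2Aαβ + Bβ is commutative, i.e. [A~, B~] = 0. -/
noncomputable section

open Set

open scoped Topology ContDiff unitInterval

/-- Pointwise application of a continuous family of linear maps. -/
def nemLin {E F G : Type} [NormedAddCommGroup E] [NormedSpace ℝ E]
    [NormedAddCommGroup F] [NormedSpace ℝ F] [NormedAddCommGroup G] [NormedSpace ℝ G]
    (b : G →L[ℝ] E →L[ℝ] F) (hb : ∀ g, ‖b g‖ ≤ ‖g‖) :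
    C(I, G) →L[ℝ] C(I, E) →L[ℝ] C(I, F) :=
  LinearMap.mkContinuous₂
    (LinearMap.mk₂ ℝ (fun (g : C(I, G)) (h : C(I, E)) =>
      (⟨fun t => b (g t) (h t), by fun_prop⟩ : C(I, F)))
      (fun _ _ _ => by ext; simp) (fun _ _ _ => by ext; simp)
      (fun _ _ _ => by ext; simp) (fun _ _ _ => by ext; simp)) 1
    (fun g h => by
      rw [one_mul]
      refine (ContinuousMap.norm_le _ (by positivity)).2 fun t => ?_
      exact (ContinuousLinearMap.le_opNorm _ _).trans
        (mul_le_mul ((hb _).trans (g.norm_coe_le_norm t)) (h.norm_coe_le_norm t) (norm_nonneg _)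
          (norm_nonneg _)))

lemma nem_hasFDerivAt {E F G : Type} [NormedAddCommGroup E] [NormedSpace ℝ E]
    [NormedAddCommGroup F] [NormedSpace ℝ F] [NormedAddCommGroup G] [NormedSpace ℝ G]
    (b : G →L[ℝ] E →L[ℝ] F) (hb : ∀ g, ‖b g‖ ≤ ‖g‖) (f : C(E, F)) (f' : C(E, G))
    (hf : ∀ x, HasFDerivAt f (b (f' x)) x) (y : C(I, E)) :
    HasFDerivAt (fun y : C(I, E) => f.comp y) (nemLin b hb (f'.comp y)) y := by
  rw [hasFDerivAt_iff_isLittleO_nhds_zero, Asymptotics.isLittleO_iff]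
  intro c hc
  have hcont : Continuous (fun y : C(I, E) => f'.comp y) := ContinuousMap.continuous_postcomp f'
  obtain ⟨δ, hδ, H⟩ := Metric.continuous_iff.1 hcont y c hc
  filter_upwards [Metric.ball_mem_nhds (0 : C(I, E)) hδ] with h hh
  rw [mem_ball_zero_iff] at hh
  refine (ContinuousMap.norm_le _ (by positivity)).2 fun t => ?_
  have key : ‖f (y t + h t) - f (y t) - b (f' (y t)) ((y t + h t) - y t)‖
      ≤ c * ‖(y t + h t) - y t‖ := by
    refine Convex.norm_image_sub_le_of_norm_hasFDerivWithin_le' (𝕜 := ℝ)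
      (s := Metric.ball (y t) δ)
      (f' := fun x => b (f' x)) (fun x _ => (hf x).hasFDerivWithinAt) (fun z hz => ?_)
      (convex_ball _ _) (Metric.mem_ball_self hδ) ?_
    · have h1 := H (y + ContinuousMap.const I (z - y t)) (by
        rw [dist_eq_norm, add_sub_cancel_left]
        refine lt_of_le_of_lt ?_ (mem_ball_iff_norm.1 hz)
        exact (ContinuousMap.norm_le _ (norm_nonneg _)).2 fun s => le_of_eq rfl)
      have h2 := (ContinuousMap.dist_apply_le_dist t).trans h1.le
      rw [← map_sub]
      refine (hb _).trans ?_
      simpa [dist_eq_norm] using h2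
    · rw [mem_ball_iff_norm, add_sub_cancel_left]
      exact (h.norm_coe_le_norm t).trans_lt hh
  rw [add_sub_cancel_left] at key
  refine le_trans (le_of_eq ?_) (key.trans (mul_le_mul_of_nonneg_left (h.norm_coe_le_norm t) hc.le))
  rfl

lemma nem_succ {E F G : Type} [NormedAddCommGroup E] [NormedSpace ℝ E]
    [NormedAddCommGroup F] [NormedSpace ℝ F] [NormedAddCommGroup G] [NormedSpace ℝ G]
    (b : G →L[ℝ] E →L[ℝ] F) (hb : ∀ g, ‖b g‖ ≤ ‖g‖) (f : C(E, F)) (f' : C(E, G))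
    (hf : ∀ x, HasFDerivAt f (b (f' x)) x) (n : ℕ)
    (hn : ContDiff ℝ n (fun y : C(I, E) => f'.comp y)) :
    ContDiff ℝ (n + 1) (fun y : C(I, E) => f.comp y) := by
  have h : ContDiff ℝ n (fun g : C(I, G) => nemLin b hb g) :=
    ContinuousLinearMap.contDiff (𝕜 := ℝ) (E := C(I, G)) (F := C(I, E) →L[ℝ] C(I, F))
      (nemLin b hb)
  exact   contDiff_succ_iff_hasFDerivAt.2 ⟨fun y => nemLin b hb (f'.comp y),
    h.comp hn, fun y => nem_hasFDerivAt b hb f f' hf y⟩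

lemma nem_contDiff_nat {E : Type} [NormedAddCommGroup E] [NormedSpace ℝ E] (n : ℕ) :
    ∀ {F : Type} [NormedAddCommGroup F] [NormedSpace ℝ F] (f : C(E, F)),
    ContDiff ℝ ∞ f → ContDiff ℝ n (fun y : C(I, E) => f.comp y) := by
  induction n with
  | zero =>
    intro F _ _ f _
    exact contDiff_zero.2 (ContinuousMap.continuous_postcomp f)
  | succ n ih =>
    intro F _ _ f hf
    have hf' : ContDiff ℝ ∞ (fderiv ℝ f) := hf.fderiv_right (by simp)
    exact nem_succ (ContinuousLinearMap.id ℝ (E →L[ℝ] F)) (fun g => le_rfl) f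
      ⟨fderiv ℝ f, hf'.continuous⟩ (fun x => (hf.differentiable (by simp) x).hasFDerivAt) n
      (ih (F := E →L[ℝ] F) ⟨fderiv ℝ f, hf'.continuous⟩ hf')

lemma nem_contDiff {E F : Type} [NormedAddCommGroup E] [NormedSpace ℝ E]
    [NormedAddCommGroup F] [NormedSpace ℝ F] (f : C(E, F)) (hf : ContDiff ℝ ∞ f) :
    ContDiff ℝ ∞ (fun y : C(I, E) => f.comp y) :=
  contDiff_infty.2 fun n => nem_contDiff_nat n f hf

/-- Integration operator. -/
def intOp (E : Type) [NormedAddCommGroup E] [NormedSpace ℝ E] : C(I, E) →L[ℝ] C(I, E) :=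
  LinearMap.mkContinuous
    { toFun := fun y => ⟨fun s => ∫ w in (0:ℝ)..s, y (projIcc 0 1 zero_le_one w), by
        have : Continuous fun s : ℝ => ∫ w in (0:ℝ)..s, y (projIcc 0 1 zero_le_one w) :=
          intervalIntegral.continuous_primitive
            (fun a b => Continuous.intervalIntegrable (by fun_prop) a b) 0
        exact this.comp continuous_subtype_val⟩
      map_add' := fun y z => by
        ext s
        exact intervalIntegral.integral_add (Continuous.intervalIntegrable (by fun_prop) _ _)
          (Continuous.intervalIntegrable (by fun_prop) _ _)
      map_smul' := fun c y => by
        ext s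
        exact intervalIntegral.integral_smul c _ } 1
    (fun y => by
      refine (ContinuousMap.norm_le _ (by positivity)).2 fun t => ?_
      refine (intervalIntegral.norm_integral_le_of_norm_le_const (C := ‖y‖)
        fun x _ => y.norm_coe_le_norm _).trans ?_
      rw [mul_comm]
      refine mul_le_mul_of_nonneg_right ?_ (norm_nonneg _)
      rw [sub_zero, abs_of_nonneg t.2.1]
      exact t.2.2)

lemma intOp_apply {E : Type} [NormedAddCommGroup E] [NormedSpace ℝ E] (y : C(I, E)) (s : I) :
    intOp E y s = ∫ w in (0:ℝ)..s, y (projIcc 0 1 zero_le_one w) := rfl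

/-- Constant functions. -/
def constOp (E : Type) [NormedAddCommGroup E] [NormedSpace ℝ E] : E →L[ℝ] C(I, E) :=
  LinearMap.mkContinuous
    { toFun := fun x => ContinuousMap.const I x
      map_add' := fun _ _ => rfl
      map_smul' := fun _ _ => rfl } 1
    (fun x => by
      rw [one_mul]
      exact (ContinuousMap.norm_le _ (norm_nonneg _)).2 fun _ => le_rfl)

/-- Smooth inverse function theorem on a neighbourhood. -/
lemma smooth_inverse {E F : Type} [NormedAddCommGroup E] [NormedSpace ℝ E] [CompleteSpace E]
    [NormedAddCommGroup F] [NormedSpace ℝ F] [CompleteSpace F] (H : E → F) (a : E)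
    (hH : ∀ᶠ x in 𝓝 a, ContDiffAt ℝ ∞ H x)
    (L : E ≃L[ℝ] F) (hL : HasFDerivAt H (L : E →L[ℝ] F) a) :
    ∃ G : F → E, (∀ᶠ x in 𝓝 a, G (H x) = x) ∧ (∀ᶠ z in 𝓝 (H a), H (G z) = z) ∧
      ∀ᶠ z in 𝓝 (H a), ContDiffAt ℝ ∞ G z := by
  have hHa : ContDiffAt ℝ ∞ H a := hH.self_of_nhds
  let e := hHa.toOpenPartialHomeomorph H hL (by simp)
  have hea : a ∈ e.source := hHa.mem_toOpenPartialHomeomorph_source hL (by simp)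
  have heH : (e : E → F) = H := rfl
  have hta : H a ∈ e.target := e.map_source hea
  have hsa : e.symm (H a) = a := e.left_inv hea
  have hequiv : ∀ᶠ x in 𝓝 a, ∃ L' : E ≃L[ℝ] F, fderiv ℝ H x = L' := by
    have hc : ContinuousAt (fderiv ℝ H) a :=
      (hHa.fderiv_right (m := 0) (by simp)).continuousAt
    have := hc.eventually (ContinuousLinearEquiv.nhds L |> fun h => by rw [hL.fderiv]; exact h)
    filter_upwards [this] with x hx
    obtain ⟨L', hL'⟩ := hx
    exact ⟨L', hL'.symm⟩
  have hcs : Filter.Tendsto e.symm (𝓝 (H a)) (𝓝 a) := by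
    have := e.continuousAt_symm hta
    rwa [ContinuousAt, hsa] at this
  refine ⟨e.symm, ?_, ?_, ?_⟩
  · filter_upwards [e.open_source.mem_nhds hea] with x hx using e.left_inv hx
  · filter_upwards [e.open_target.mem_nhds hta] with x hx using e.right_inv hx
  · filter_upwards [e.open_target.mem_nhds hta, hcs.eventually hequiv, hcs.eventually hH]
      with z hz h1 h2
    obtain ⟨L', hL'⟩ := h1
    refine e.contDiffAt_symm (f₀' := L') hz ?_ h2
    rw [← hL', heH]
    exact (h2.differentiableAt (by simp)).hasFDerivAt

lemma smooth_flow {E : Type} [NormedAddCommGroup E] [NormedSpace ℝ E] [CompleteSpace E]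
    (V : E → E) (hV : ContDiff ℝ ∞ V) (x₀ : E) :
    ∃ Φ : ℝ × E → E, ∀ᶠ p in 𝓝 ((0 : ℝ), x₀), ContDiffAt ℝ ∞ Φ p ∧
      HasDerivAt (fun t => Φ (t, p.2)) (V (Φ p)) p.1 ∧ Φ (0, p.2) = p.2 := by
  obtain ⟨ε, hε, a, r, L, K, hr, hPL⟩ :=
    IsPicardLindelof.of_contDiffAt_one (hV.contDiffAt (x := x₀) |>.of_le (by simp))
  obtain ⟨α, hα, hαc⟩ := (hPL 0).exists_forall_mem_closedBall_eq_hasDerivWithinAt_continuousOn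
  simp only [zero_sub, zero_add] at hα hαc
  have hr' : (0:ℝ) < r := hr
  let Vc : C(E, E) := ⟨V, hV.continuous⟩
  let H : (ℝ × E) × C(I, E) → (ℝ × E) × C(I, E) := fun q =>
    (q.1, q.2 - constOp E q.1.2 - q.1.1 • intOp E (Vc.comp q.2))
  have hN : ContDiff ℝ ∞ (fun y : C(I, E) => Vc.comp y) := nem_contDiff Vc hV
  have hH : ContDiff ℝ ∞ H := by
    refine contDiff_fst.prodMk ((contDiff_snd.sub ?_).sub ?_)
    · exact (constOp E).contDiff.comp (contDiff_snd.comp contDiff_fst)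
    · exact (contDiff_fst.comp contDiff_fst).smul
        ((intOp E).contDiff.comp (hN.comp contDiff_snd))
  let y₀ : C(I, E) := ContinuousMap.const I x₀
  let q₀ : (ℝ × E) × C(I, E) := ((0, x₀), y₀)
  let M : (ℝ × E) →L[ℝ] C(I, E) :=
    -((constOp E).comp (ContinuousLinearMap.snd ℝ ℝ E)) -
      (ContinuousLinearMap.fst ℝ ℝ E).smulRight (intOp E (Vc.comp y₀))
  let Lq : ((ℝ × E) × C(I, E)) ≃L[ℝ] ((ℝ × E) × C(I, E)) :=
    (ContinuousLinearEquiv.refl ℝ _).skewProd (ContinuousLinearEquiv.refl ℝ _) M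
  have hL : HasFDerivAt H (Lq : _ →L[ℝ] _) q₀ := by
    have h1 : HasFDerivAt (fun q : (ℝ × E) × C(I, E) => q.1)
      (ContinuousLinearMap.fst ℝ (ℝ × E) C(I, E)) q₀ := hasFDerivAt_fst
    have h2 : HasFDerivAt (fun q : (ℝ × E) × C(I, E) => q.2)
      (ContinuousLinearMap.snd ℝ (ℝ × E) C(I, E)) q₀ := hasFDerivAt_snd
    have h3 := (constOp E).hasFDerivAt.comp q₀ (h1.snd)
    have h4 : DifferentiableAt ℝ (fun q : (ℝ × E) × C(I, E) => intOp E (Vc.comp q.2)) q₀ :=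
      ((intOp E).contDiff.comp (hN.comp contDiff_snd)).contDiffAt.differentiableAt
        (n := ∞) (by simp)
    have h5 := h1.prodMk ((h2.sub h3).sub (h1.fst.smul h4.hasFDerivAt))
    refine h5.congr_fderiv ?_
    refine ContinuousLinearMap.ext fun q => ?_
    refine Prod.ext ?_ ?_
    · simp [Lq]
    · simp [Lq, M, q₀, sub_eq_add_neg, add_assoc]
  obtain ⟨G, hG1, -, hG3⟩ := smooth_inverse H q₀ (.of_forall fun _ => hH.contDiffAt) Lq hL
  have hHq₀ : H q₀ = ((0, x₀), 0) := by
    refine Prod.ext rfl ?_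
    change y₀ - constOp E x₀ - (0:ℝ) • _ = 0
    rw [zero_smul, sub_zero]
    exact sub_self y₀
  rw [hHq₀] at hG3
  obtain ⟨δ, hδ, hG1⟩ := Metric.eventually_nhds_iff.1 hG1
  -- continuity of α at the base point
  have hx₀r : x₀ ∈ Metric.closedBall x₀ (r:ℝ) := Metric.mem_closedBall_self hr'.le
  have hα0 : α (x₀, 0) = x₀ := (hα x₀ hx₀r).1
  have hαat : ContinuousAt α (x₀, 0) :=
    hαc.continuousAt (prod_mem_nhds (Metric.closedBall_mem_nhds _ hr')
      (Icc_mem_nhds (by linarith) hε))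
  obtain ⟨η, hη, hαη⟩ := Metric.continuousAt_iff.1 hαat δ hδ
  have hclaim : ∀ p : ℝ × E, dist p (0, x₀) < min (min η δ) (min ε r) →
      α (p.2, p.1) = (G (p, 0)).2 1 := by
    rintro ⟨τ, x⟩ hp
    simp only [lt_min_iff, Prod.dist_eq, max_lt_iff, dist_zero_right, Real.norm_eq_abs] at hp
    obtain ⟨⟨⟨hτη, hxη⟩, ⟨hτδ, hxδ⟩⟩, ⟨hτε, -⟩, ⟨-, hxr⟩⟩ := hp
    obtain ⟨hx0, hxd⟩ := hα x (Metric.mem_closedBall.2 hxr.le)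
    have hmem : ∀ s : I, τ * (s:ℝ) ∈ Icc (-ε) ε := fun s => by
      rw [mem_Icc, ← abs_le, abs_mul, abs_of_nonneg s.2.1]
      exact (mul_le_of_le_one_right (abs_nonneg _) s.2.2).trans hτε.le
    have hcont : ContinuousOn (fun t => α (x, t)) (Icc (-ε) ε) :=
      fun t ht => (hxd t ht).continuousWithinAt
    let y : C(I, E) := ⟨fun s => α (x, τ * s),
      hcont.comp_continuous (by fun_prop) hmem⟩
    have hHy : H ((τ, x), y) = ((τ, x), 0) := by
      refine Prod.ext rfl ?_
      ext s
      change α (x, τ * s) - x - τ • intOp E (Vc.comp y) s = 0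
      have hftc : ∫ w in (0:ℝ)..s, τ • V (α (x, τ * w)) = α (x, τ * s) - α (x, τ * 0) := by
        refine intervalIntegral.integral_eq_sub_of_hasDerivAt_of_le (f := fun w => α (x, τ * w))
          s.2.1 ?_ ?_ ?_
        · refine hcont.comp (by fun_prop) fun w hw => hmem ⟨w, hw.1, hw.2.trans s.2.2⟩
        · intro w hw
          have hm : τ * w ∈ Ioo (-ε) ε := by
            rw [mem_Ioo, ← abs_lt, abs_mul, abs_of_pos hw.1]
            exact lt_of_le_of_lt
              (mul_le_of_le_one_right (abs_nonneg _) (hw.2.le.trans s.2.2)) hτε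
          have h1 := (hxd _ (Ioo_subset_Icc_self hm)).hasDerivAt (Icc_mem_nhds hm.1 hm.2)
          have h2 : HasDerivAt (fun w : ℝ => τ * w) τ w := by
            simpa using (hasDerivAt_id w).const_mul τ
          exact h1.scomp w h2
        · refine ContinuousOn.intervalIntegrable ?_
          rw [uIcc_of_le s.2.1]
          refine (hV.continuous.comp_continuousOn (hcont.comp (by fun_prop)
            fun w hw => hmem ⟨w, hw.1, hw.2.trans s.2.2⟩)).const_smul τ
      rw [mul_zero, hx0, intervalIntegral.integral_smul] at hftc
      rw [intOp_apply, ← hftc, sub_eq_zero]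
      congr 1
      refine intervalIntegral.integral_congr fun w hw => ?_
      rw [uIcc_of_le s.2.1] at hw
      have : projIcc (0:ℝ) 1 zero_le_one w = ⟨w, hw.1, hw.2.trans s.2.2⟩ :=
        projIcc_of_mem _ _
      simp only [this]
      rfl
    have hdy : dist y y₀ < δ := by
      refine (ContinuousMap.dist_lt_iff hδ).2 fun s => ?_
      have := @hαη (x, τ * s) (by
        rw [Prod.dist_eq, max_lt_iff]
        refine ⟨hxη, ?_⟩
        simp only [dist_zero_right, Real.norm_eq_abs]
        rw [abs_mul, abs_of_nonneg s.2.1]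
        exact (mul_le_of_le_one_right (abs_nonneg _) s.2.2).trans_lt hτη)
      rwa [hα0] at this
    have := @hG1 ((τ, x), y) (by
      rw [Prod.dist_eq, max_lt_iff, Prod.dist_eq, max_lt_iff]
      refine ⟨⟨?_, hxδ⟩, hdy⟩
      change dist τ 0 < δ
      simpa using hτδ)
    rw [hHy] at this
    rw [this]
    change _ = α (x, τ * ((1 : I) : ℝ))
    simp
  have hρ : 0 < min (min η δ) (min ε (r:ℝ)) := by positivity
  have hev := Metric.ball_mem_nhds ((0 : ℝ), x₀) hρ
  have hev' : ∀ᶠ p in 𝓝 ((0 : ℝ), x₀), ContDiffAt ℝ ∞ G (p, 0) := by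
    have : Filter.Tendsto (fun p : ℝ × E => (p, (0 : C(I, E)))) (𝓝 (0, x₀))
        (𝓝 ((0, x₀), 0)) := (Continuous.tendsto (by fun_prop) _)
    exact this.eventually hG3
  refine ⟨fun p => α (p.2, p.1), ?_⟩
  filter_upwards [eventually_mem_nhds_iff.2 hev, hev', hev] with p hp1 hp2 hp3
  refine ⟨?_, ?_, ?_⟩
  · have h1 : ContDiffAt ℝ ∞ (fun p : ℝ × E => (G (p, 0)).2 1) p := by
      have h2 : ContDiffAt ℝ ∞ (fun p : ℝ × E => G (p, 0)) p :=
        hp2.comp p (contDiffAt_id.prodMk contDiffAt_const)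
      exact (ContinuousMap.evalCLM ℝ (1 : I)).contDiff.contDiffAt.comp p h2.snd
    refine h1.congr_of_eventuallyEq ?_
    filter_upwards [hp1] with p' hp' using hclaim p' hp'
  · rcases p with ⟨τ, x⟩
    simp only [Metric.mem_ball, lt_min_iff, Prod.dist_eq, max_lt_iff, dist_zero_right,
      Real.norm_eq_abs] at hp3
    have := (abs_lt.1 hp3.2.1.1)
    exact ((hα x (Metric.mem_closedBall.2 hp3.2.2.2.le)).2 τ ⟨this.1.le, this.2.le⟩).hasDerivAt
      (Icc_mem_nhds this.1 this.2)
  · rcases p with ⟨τ, x⟩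
    simp only [Metric.mem_ball, lt_min_iff, Prod.dist_eq, max_lt_iff] at hp3
    exact (hα x (Metric.mem_closedBall.2 hp3.2.2.2.le)).1

lemma globalize {F : Type} [NormedAddCommGroup F] [NormedSpace ℝ F] {U : Set (ℝ × ℝ)}
    (hU : IsOpen U) {x₀ : ℝ × ℝ} (hx₀ : x₀ ∈ U) {g : ℝ × ℝ → F} (hg : ContDiffOn ℝ ∞ g U) :
    ∃ g' : ℝ × ℝ → F, ContDiff ℝ ∞ g' ∧ ∀ᶠ x in 𝓝 x₀, g' x = g x := by
  obtain ⟨ε, hε, hεU⟩ := Metric.isOpen_iff.1 hU x₀ hx₀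
  let χ : ContDiffBump x₀ := ⟨ε / 4, ε / 2, by positivity, by linarith⟩
  refine ⟨fun x => χ x • g x, contDiff_iff_contDiffAt.2 fun x => ?_, ?_⟩
  · by_cases hx : x ∈ tsupport χ
    · rw [χ.tsupport_eq] at hx
      have h2 : x ∈ U := hεU (Metric.closedBall_subset_ball (by simp [χ]; linarith) hx)
      exact χ.contDiff.contDiffAt.smul (hg.contDiffAt (hU.mem_nhds h2))
    · refine (contDiffAt_const (c := (0 : F))).congr_of_eventuallyEq ?_
      filter_upwards [notMem_tsupport_iff_eventuallyEq.1 hx] with y hy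
      rw [hy]
      simp
  · filter_upwards [χ.eventuallyEq_one] with x hx
    rw [hx]
    simp

lemma equiv_of_indep (D : ℝ × ℝ →L[ℝ] ℝ × ℝ)
    (h : LinearIndependent ℝ ![D (1, 0), D (0, 1)]) :
    ∃ L : (ℝ × ℝ) ≃L[ℝ] (ℝ × ℝ), (L : ℝ × ℝ →L[ℝ] ℝ × ℝ) = D := by
  have hinj : Function.Injective (D : ℝ × ℝ →ₗ[ℝ] ℝ × ℝ) := by
    rw [← LinearMap.ker_eq_bot, LinearMap.ker_eq_bot']
    rintro ⟨s, t⟩ hst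
    have h1 : s • D (1, 0) + t • D (0, 1) = 0 := by
      rw [← map_smul, ← map_smul, ← map_add]
      simpa using hst
    obtain ⟨h2, h3⟩ := LinearIndependent.pair_iff.1 h s t h1
    rw [h2, h3]
    rfl
  refine ⟨(LinearEquiv.ofInjectiveEndo _ hinj).toContinuousLinearEquiv, ?_⟩
  ext <;> rfl

lemma solve {U : Set (ℝ × ℝ)}
    (hU : IsOpen U) {x₀ : ℝ × ℝ} (hx₀ : x₀ ∈ U) {A : ℝ × ℝ → ℝ × ℝ} (hA : ContDiffOn ℝ ∞ A U)
    {f : ℝ × ℝ → ℝ} (hf : ContDiffOn ℝ ∞ f U) (v : ℝ × ℝ)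
    (hv : LinearIndependent ℝ ![A x₀, v]) :
    ∃ (u : ℝ × ℝ → ℝ) (U₀ : Set (ℝ × ℝ)), IsOpen U₀ ∧ x₀ ∈ U₀ ∧ U₀ ⊆ U ∧
      ContDiffOn ℝ ∞ u U₀ ∧ ∀ x ∈ U₀, fderiv ℝ u x (A x) = f x := by
  obtain ⟨A', hA', hAA⟩ := globalize hU hx₀ hA
  obtain ⟨f', hf', hff⟩ := globalize hU hx₀ hf
  let V : (ℝ × ℝ) × ℝ → (ℝ × ℝ) × ℝ := fun q => (A' q.1, f' q.1)
  have hV : ContDiff ℝ ∞ V := (hA'.comp contDiff_fst).prodMk (hf'.comp contDiff_fst)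
  obtain ⟨Φ, hΦ⟩ := smooth_flow V hV (x₀, 0)
  let ι : ℝ × ℝ → ℝ × ((ℝ × ℝ) × ℝ) := fun a => (a.1, (x₀ + a.2 • v, 0))
  have hι : ContDiff ℝ ∞ ι := by fun_prop
  have hι0 : ι (0, 0) = (0, (x₀, 0)) := by simp [ι]
  have hιt : Filter.Tendsto ι (𝓝 (0, 0)) (𝓝 (0, (x₀, 0))) := by
    rw [← hι0]
    exact hι.continuous.tendsto _
  have hev := hιt.eventually hΦ
  let Ψ : ℝ × ℝ → ℝ × ℝ := fun a => (Φ (ι a)).1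
  let W : ℝ × ℝ → ℝ := fun a => (Φ (ι a)).2
  have hQ : ∀ᶠ a in 𝓝 ((0 : ℝ), (0 : ℝ)), ContDiffAt ℝ ∞ (fun a => Φ (ι a)) a := by
    filter_upwards [hev] with a ha
    exact ha.1.comp a hι.contDiffAt
  have hΨs : ∀ᶠ a in 𝓝 ((0 : ℝ), (0 : ℝ)), ContDiffAt ℝ ∞ Ψ a := by
    filter_upwards [hQ] with a ha using ha.fst
  have hWs : ∀ᶠ a in 𝓝 ((0 : ℝ), (0 : ℝ)), ContDiffAt ℝ ∞ W a := by
    filter_upwards [hQ] with a ha using ha.snd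
  have hder : ∀ᶠ a in 𝓝 ((0 : ℝ), (0 : ℝ)),
      HasDerivAt (fun t => Ψ (t, a.2)) (A' (Ψ a)) a.1 ∧
      HasDerivAt (fun t => W (t, a.2)) (f' (Ψ a)) a.1 := by
    filter_upwards [hev] with a ha
    exact ⟨ha.2.1.fst, ha.2.1.snd⟩
  have hΨ0 : ∀ᶠ s in 𝓝 (0 : ℝ), Ψ (0, s) = x₀ + s • v := by
    have ht : Filter.Tendsto (fun s : ℝ => ((0:ℝ), s)) (𝓝 0) (𝓝 (0, 0)) :=
      Continuous.tendsto (by fun_prop) _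
    filter_upwards [ht.eventually hev] with s hs
    change (Φ (0, (ι (0, s)).2)).1 = _
    rw [hs.2.2]
  have hΨ00 : Ψ (0, 0) = x₀ := by simpa using hΨ0.self_of_nhds
  have hA0 : A' x₀ = A x₀ := hAA.self_of_nhds
  have hΨd : HasFDerivAt Ψ (fderiv ℝ Ψ (0, 0)) (0, 0) :=
    (hΨs.self_of_nhds.differentiableAt (by simp)).hasFDerivAt
  have hD1 : fderiv ℝ Ψ (0, 0) (1, 0) = A x₀ := by
    have h1 : HasDerivAt (fun t : ℝ => (t, (0:ℝ))) (1, 0) 0 :=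
      (hasDerivAt_id (0:ℝ)).prodMk (hasDerivAt_const _ _)
    have h2 := HasFDerivAt.comp_hasDerivAt (f := fun t : ℝ => (t, (0:ℝ))) 0 hΨd h1
    have h3 := hder.self_of_nhds.1
    rw [hΨ00, hA0] at h3
    exact h2.unique h3
  have hD2 : fderiv ℝ Ψ (0, 0) (0, 1) = v := by
    have h1 : HasDerivAt (fun t : ℝ => ((0:ℝ), t)) (0, 1) 0 :=
      (hasDerivAt_const _ _).prodMk (hasDerivAt_id (0:ℝ))
    have h2 := HasFDerivAt.comp_hasDerivAt (f := fun t : ℝ => ((0:ℝ), t)) 0 hΨd h1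
    have h3 : HasDerivAt (fun s : ℝ => x₀ + s • v) v 0 := by
      simpa using ((hasDerivAt_id (0:ℝ)).smul_const v).const_add x₀
    exact h2.unique (h3.congr_of_eventuallyEq hΨ0)
  obtain ⟨L, hL⟩ := equiv_of_indep (fderiv ℝ Ψ (0, 0)) (by rw [hD1, hD2]; exact hv)
  obtain ⟨G, hG1, hG2, hG3⟩ := smooth_inverse Ψ (0, 0) hΨs L (by rw [hL]; exact hΨd)
  have hG0 : G x₀ = (0, 0) := by
    have := hG1.self_of_nhds
    rwa [hΨ00] at this
  rw [hΨ00] at hG2 hG3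
  have hGt : Filter.Tendsto G (𝓝 x₀) (𝓝 (0, 0)) := by
    rw [← hG0]
    exact hG3.self_of_nhds.continuousAt
  have hfin : ∀ᶠ z in 𝓝 x₀, z ∈ U ∧ ContDiffAt ℝ ∞ (fun z => W (G z)) z ∧
      fderiv ℝ (fun z => W (G z)) z (A z) = f z := by
    filter_upwards [hU.mem_nhds hx₀, hG2, hG3, hGt.eventually hWs, hGt.eventually hder,
      hGt.eventually hG1.eventually_nhds, hAA, hff] with z hzU h2 h3 hW hd hG1z hAz hfz
    have hsm : ContDiffAt ℝ ∞ (fun z => W (G z)) z := hW.comp z h3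
    refine ⟨hzU, hsm, ?_⟩
    have hfd := (hsm.differentiableAt (by simp)).hasFDerivAt
    obtain ⟨hd1, hd2⟩ := hd
    rw [h2] at hd1 hd2
    rw [hAz] at hd1
    rw [hfz] at hd2
    have hfd' : HasFDerivAt (fun z => W (G z)) (fderiv ℝ (fun z => W (G z)) z)
        ((fun t => Ψ (t, (G z).2)) (G z).1) := by
      have hz : (fun t => Ψ (t, (G z).2)) (G z).1 = z := h2
      rw [hz]
      exact hfd
    have h5 := HasFDerivAt.comp_hasDerivAt (f := fun t => Ψ (t, (G z).2)) (G z).1 hfd' hd1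
    refine h5.unique (hd2.congr_of_eventuallyEq ?_)
    have ht : Filter.Tendsto (fun t : ℝ => (t, (G z).2)) (𝓝 (G z).1) (𝓝 (G z)) :=
      Continuous.tendsto' (by fun_prop) _ _ rfl
    filter_upwards [ht.eventually hG1z] with t ht'
    simp only [Function.comp]
    rw [ht']
  obtain ⟨U₀, h1, h2, h3⟩ := eventually_nhds_iff.1 hfin
  exact ⟨fun z => W (G z), U₀, h2, h3, fun x hx => (h1 x hx).1,
    fun x hx => (h1 x hx).2.1.contDiffWithinAt, fun x hx => (h1 x hx).2.2⟩

/-- for any P-frame `(A,B)` (smooth, pointwise linearly independent vector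
fields on an open subset of `ℝ²`) and any point `x₀`, there exist, locally around `x₀`,
smooth functions `α` and `β` with `β` nonvanishing such that the transformed P-frame
`A~ = Aβ²`, `B~ = 2Aαβ + Bβ` is commutative: `[A~, B~] = 0`. -/
theorem stmt_18 (U : Set (ℝ × ℝ)) (hU : IsOpen U) (x₀ : ℝ × ℝ) (hx₀ : x₀ ∈ U)
    (A B : (ℝ × ℝ) → ℝ × ℝ)
    (hA : ContDiffOn ℝ (⊤ : ℕ∞) A U) (hB : ContDiffOn ℝ (⊤ : ℕ∞) B U)
    (hAB : ∀ x ∈ U, LinearIndependent ℝ ![A x, B x]) :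
    ∃ (α β : (ℝ × ℝ) → ℝ) (U₀ : Set (ℝ × ℝ)), IsOpen U₀ ∧ x₀ ∈ U₀ ∧ U₀ ⊆ U ∧
      ContDiffOn ℝ (⊤ : ℕ∞) α U₀ ∧ ContDiffOn ℝ (⊤ : ℕ∞) β U₀ ∧ (∀ x ∈ U₀, β x ≠ 0) ∧
      ∀ x ∈ U₀,
        lieB (fun y => (β y) ^ 2 • A y)
             (fun y => (2 * α y * β y) • A y + β y • B y) x = 0 := by
  have hd : ∀ x ∈ U, (A x).1 * (B x).2 - (A x).2 * (B x).1 ≠ 0 := by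
    intro x hx h0
    have hli := LinearIndependent.pair_iff.1 (hAB x hx)
    have h1 := hli (B x).2 (-(A x).2) (by
      refine Prod.ext ?_ ?_
      · simp; linarith
      · simp; ring)
    have h2 := hli (B x).1 (-(A x).1) (by
      refine Prod.ext ?_ ?_
      · simp; ring
      · simp; linarith)
    have h3 := hli 0 1 (by
      refine Prod.ext ?_ ?_
      · simp [h2.1]
      · simp [h1.1])
    exact one_ne_zero h3.2
  have hC : ContDiffOn ℝ ∞ (lieB A B) U := by
    refine ContDiffOn.sub ?_ ?_
    · exact (hB.fderiv_of_isOpen hU (by simp)).clm_apply hA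
    · exact (hA.fderiv_of_isOpen hU (by simp)).clm_apply hB
  obtain ⟨p, hp⟩ : ∃ p : ℝ × ℝ → ℝ, p = fun x =>
    ((lieB A B x).1 * (B x).2 - (lieB A B x).2 * (B x).1) /
      ((A x).1 * (B x).2 - (A x).2 * (B x).1) := ⟨_, rfl⟩
  obtain ⟨q, hq⟩ : ∃ q : ℝ × ℝ → ℝ, q = fun x =>
    ((A x).1 * (lieB A B x).2 - (A x).2 * (lieB A B x).1) /
      ((A x).1 * (B x).2 - (A x).2 * (B x).1) := ⟨_, rfl⟩
  have hps : ContDiffOn ℝ ∞ p U := by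
    rw [hp]
    exact ((hC.fst.mul hB.snd).sub (hC.snd.mul hB.fst)).div
      ((hA.fst.mul hB.snd).sub (hA.snd.mul hB.fst)) hd
  have hqs : ContDiffOn ℝ ∞ q U := by
    rw [hq]
    exact ((hA.fst.mul hC.snd).sub (hA.snd.mul hC.fst)).div
      ((hA.fst.mul hB.snd).sub (hA.snd.mul hB.fst)) hd
  have hpq : ∀ x ∈ U, fderiv ℝ B x (A x) - fderiv ℝ A x (B x) = p x • A x + q x • B x := by
    intro x hx
    have := hd x hx
    change lieB A B x = _
    rw [hp, hq]
    refine Prod.ext ?_ ?_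
    · simp only [Prod.fst_add, Prod.smul_fst, smul_eq_mul]
      rw [div_mul_eq_mul_div, div_mul_eq_mul_div, ← add_div, eq_div_iff this]
      ring
    · simp only [Prod.snd_add, Prod.smul_snd, smul_eq_mul]
      rw [div_mul_eq_mul_div, div_mul_eq_mul_div, ← add_div, eq_div_iff this]
      ring
  obtain ⟨u, U₁, hU₁, hx₁, hU₁U, hu, hue⟩ := solve hU hx₀ hA hqs.neg (B x₀) (hAB x₀ hx₀)
  obtain ⟨β, hβ⟩ : ∃ β : ℝ × ℝ → ℝ, β = fun x => Real.exp (u x) := ⟨_, rfl⟩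
  have hβs : ContDiffOn ℝ ∞ β U₁ := by rw [hβ]; exact hu.exp
  have hβ0 : ∀ x, β x ≠ 0 := fun x => by rw [hβ]; exact (Real.exp_pos _).ne'
  have hβe : ∀ x ∈ U₁, fderiv ℝ β x (A x) = - (β x * q x) := by
    intro x hx
    have h1 := ((hu.contDiffAt (hU₁.mem_nhds hx)).differentiableAt (by simp)).hasFDerivAt.exp
    rw [hβ, h1.fderiv]
    change Real.exp (u x) • fderiv ℝ u x (A x) = _
    rw [hue x hx]
    simp
  have hg : ContDiffOn ℝ ∞ (fun x => (2 * fderiv ℝ β x (B x) - β x * p x) / (β x) ^ 2) U₁ := by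
    refine ((contDiffOn_const.mul ?_).sub (hβs.mul (hps.mono hU₁U))).div (hβs.pow 2)
      (fun x _ => pow_ne_zero 2 (hβ0 x))
    exact (hβs.fderiv_of_isOpen hU₁ (by simp)).clm_apply (hB.mono hU₁U)
  obtain ⟨c, U₂, hU₂, hx₂, hU₂₁, hc, hce⟩ :=
    solve hU₁ hx₁ (hA.mono hU₁U) hg (B x₀) (hAB x₀ hx₀)
  refine ⟨fun x => β x * c x / 2, β, U₂, hU₂, hx₂, hU₂₁.trans hU₁U,
    ((hβs.mono hU₂₁).mul hc).div_const 2, hβs.mono hU₂₁, fun x _ => hβ0 x, ?_⟩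
  intro x hx
  have hx1 := hU₂₁ hx
  have hxU := hU₁U hx1
  have dA := ((hA.contDiffAt (hU.mem_nhds hxU)).differentiableAt (by simp)).hasFDerivAt
  have dB := ((hB.contDiffAt (hU.mem_nhds hxU)).differentiableAt (by simp)).hasFDerivAt
  have dβ := ((hβs.contDiffAt (hU₁.mem_nhds hx1)).differentiableAt (by simp)).hasFDerivAt
  have dc := ((hc.contDiffAt (hU₂.mem_nhds hx)).differentiableAt (by simp)).hasFDerivAt
  have e : (fun y => (2 * (β y * c y / 2) * β y) • A y + β y • B y) =
      fun y => ((β y ^ 2) * c y) • A y + β y • B y := by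
    funext y
    congr 2
    ring
  have hc' : fderiv ℝ c x (A x) * β x ^ 2 = 2 * fderiv ℝ β x (B x) - β x * p x := by
    rw [hce x hx, div_mul_cancel₀ _ (pow_ne_zero 2 (hβ0 x))]
  have hb' := hβe x hx1
  have hpq' := hpq x hxU
  rw [e]
  have d1 := (dβ.pow 2).smul dA
  have d2 := (((dβ.pow 2).mul dc).smul dA).add (dβ.smul dB)
  have e1 : fderiv ℝ (fun y => (β y) ^ 2 • A y) x = _ := d1.fderiv
  have e2 : fderiv ℝ (fun y => ((β y ^ 2) * c y) • A y + β y • B y) x = _ := d2.fderiv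
  unfold lieB
  rw [e1, e2]
  simp only [add_apply, smul_apply,
    ContinuousLinearMap.smulRight_apply, map_add, map_smul, smul_eq_mul, hb', Pi.mul_apply, nsmul_eq_mul, Nat.cast_ofNat, Nat.add_one_sub_one, pow_one]
  have h1 : (fderiv ℝ c x (A x) * β x ^ 2) • A x =
      (2 * fderiv ℝ β x (B x) - β x * p x) • A x := by rw [hc']
  linear_combination (norm := module) (β x ^ 3) • hpq' + (β x ^ 2) • h1
end
end
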